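/- Consider the normalization rules on Why[X]-annotated ELHI⊥ ontologies: NF₁ replaces (C ⊓ D̂ ⊑ E, v) by (D̂ ⊑ A, 1) and (C ⊓ A ⊑ E, v); NF₂ replaces (∃P.Ĉ ⊑ D, v) by (Ĉ ⊑ A, 1) and (∃P.A ⊑ D, v); NF₃ replaces (Ĉ ⊑ ∃P, v) by (Ĉ ⊑ A, 1) and (A ⊑ ∃P, v); here Ĉ, D̂ are ELHI concepts that are neither concept names nor ⊤, and A is a fresh concept name. Let O' be obtained from a Why[X]-annotated ELHI⊥ ontology O by a finite sequence of applications of NF₁–NF₃. Then: (1) every Why[X]-annotated model of O' is a model of O; (2) for every axiom α all of whose concept names occur in O and every monomial m over X, if O' ⊨ (α,m) then O ⊨ (α,m). -/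

import Mathlib

namespace DLProv

/-! ### Syntax of ELHI⊥ -/

/-- A role: a role name or an inverse role. Role names are natural numbers. -/
inductive DLRole : Type
  | name : ℕ → DLRole
  | inv : ℕ → DLRole
deriving DecidableEq

/-- The underlying role name of a role. -/
def DLRole.base : DLRole → ℕ
  | .name R => R
  | .inv R => R

/-- The inverse of a role. -/
def DLRole.invr : DLRole → DLRole
  | .name R => .inv R
  | .inv R => .name R

/-- ELHI⊥ concepts (built from concept names, ⊤, ⊥, ⊓ and ∃P.C). -/
inductive DLConcept : Type
  | top : DLConcept
  | bot : DLConcept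
  | atom : ℕ → DLConcept
  | inter : DLConcept → DLConcept → DLConcept
  | exis : DLRole → DLConcept → DLConcept
deriving DecidableEq

namespace DLConcept

/-- ELHI concepts: those not mentioning ⊥. -/
def botFree : DLConcept → Prop
  | top => True
  | bot => False
  | atom _ => True
  | inter C D => C.botFree ∧ D.botFree
  | exis _ C => C.botFree

/-- Basic concepts: concept names and concepts of the form ∃P (= ∃P.⊤). -/
def isBasic (C : DLConcept) : Prop := (∃ A, C = atom A) ∨ ∃ P, C = exis P top

/-- Admissible right-hand sides of GCIs: ⊥, a concept name, or ∃P. -/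
def isRHS (C : DLConcept) : Prop := C = bot ∨ (∃ A, C = atom A) ∨ ∃ P, C = exis P top

/-- A concept name or ⊤. -/
def isAtomic (C : DLConcept) : Prop := C = top ∨ ∃ A, C = atom A

/-- Concept names occurring in a concept. -/
def concNames : DLConcept → Finset ℕ
  | top => ∅
  | bot => ∅
  | atom A => {A}
  | inter C D => C.concNames ∪ D.concNames
  | exis _ C => C.concNames

/-- Role names occurring in a concept. -/
def roleNames : DLConcept → Finset ℕ
  | top => ∅
  | bot => ∅
  | atom _ => ∅
  | inter C D => C.roleNames ∪ D.roleNames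
  | exis P C => insert P.base C.roleNames

end DLConcept

/-- ELHI⊥ axioms: concept assertions A(a), role assertions R(a,b),
role inclusions P ⊑ Q, negative role inclusions P ⊓ Q ⊑ ⊥, and GCIs C ⊑ D. -/
inductive DLAxiom : Type
  | cassert : ℕ → ℕ → DLAxiom
  | rassert : ℕ → ℕ → ℕ → DLAxiom
  | roleInc : DLRole → DLRole → DLAxiom
  | roleDisj : DLRole → DLRole → DLAxiom
  | gci : DLConcept → DLConcept → DLAxiom
deriving DecidableEq

namespace DLAxiom

/-- Well-formedness: the right-hand side of a GCI is ⊥, a concept name, or ∃P. -/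
def wf : DLAxiom → Prop
  | gci _ D => D.isRHS
  | _ => True

def isAssertion : DLAxiom → Prop
  | cassert _ _ => True
  | rassert _ _ _ => True
  | _ => False

def concNames : DLAxiom → Finset ℕ
  | cassert A _ => {A}
  | rassert _ _ _ => ∅
  | roleInc _ _ => ∅
  | roleDisj _ _ => ∅
  | gci C D => C.concNames ∪ D.concNames

def roleNames : DLAxiom → Finset ℕ
  | cassert _ _ => ∅
  | rassert R _ _ => {R}
  | roleInc P Q => {P.base, Q.base}
  | roleDisj P Q => {P.base, Q.base}
  | gci C D => C.roleNames ∪ D.roleNames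

def indNames : DLAxiom → Finset ℕ
  | cassert _ a => {a}
  | rassert _ a b => {a, b}
  | _ => ∅

/-- ⊥ does not occur in the axiom. -/
def botFree : DLAxiom → Prop
  | cassert _ _ => True
  | rassert _ _ _ => True
  | roleInc _ _ => True
  | roleDisj _ _ => False
  | gci C D => C.botFree ∧ D.botFree

/-- Normal form: every GCI is of one of the forms A₁ ⊓ A₂ ⊑ B, ∃P.A ⊑ B, or A ⊑ ∃P,
with A, A₁, A₂ ∈ N_C ∪ {⊤} and B ∈ N_C ∪ {⊥}. -/
def inNF : DLAxiom → Prop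
  | gci C D =>
      (∃ C₁ C₂, C = .inter C₁ C₂ ∧ C₁.isAtomic ∧ C₂.isAtomic ∧ (D = .bot ∨ ∃ B, D = .atom B)) ∨
      (∃ P C', C = .exis P C' ∧ C'.isAtomic ∧ (D = .bot ∨ ∃ B, D = .atom B)) ∨
      (C.isAtomic ∧ ∃ P, D = .exis P .top)
  | _ => True

end DLAxiom

/-! ### Annotated interpretations over a commutative semiring -/

/-- A 𝕂-annotated interpretation with domain `dom` inside the type `Δ`. -/
structure Interp (Δ : Type) (K : Type) where
  dom : Set Δ
  dom_nonempty : dom.Nonempty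
  indiv : ℕ → Δ
  indiv_mem : ∀ a, indiv a ∈ dom
  conc : ℕ → Set (Δ × K)
  conc_mem : ∀ A p, p ∈ conc A → p.1 ∈ dom
  role : ℕ → Set (Δ × Δ × K)
  role_mem : ∀ R p, p ∈ role R → p.1 ∈ dom ∧ p.2.1 ∈ dom

variable {Δ Δ' K : Type}

/-- Annotated extension of a role. -/
def DLRole.interp (I : Interp Δ K) : DLRole → Set (Δ × Δ × K)
  | .name R => I.role R
  | .inv R => {p | (p.2.1, p.1, p.2.2) ∈ I.role R}

/-- Annotated extension of a concept. -/
def DLConcept.interp [CommSemiring K] (I : Interp Δ K) : DLConcept → Set (Δ × K)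
  | .top => {p | p.1 ∈ I.dom ∧ p.2 = 1}
  | .bot => ∅
  | .atom A => I.conc A
  | .inter C D => {p | ∃ d κ₁ κ₂, (d, κ₁) ∈ DLConcept.interp I C ∧
      (d, κ₂) ∈ DLConcept.interp I D ∧ p = (d, κ₁ * κ₂)}
  | .exis P C => {p | ∃ d e κ₁ κ₂, (d, e, κ₁) ∈ DLRole.interp I P ∧
      (e, κ₂) ∈ DLConcept.interp I C ∧ p = (d, κ₁ * κ₂)}

/-- Satisfaction of an annotated axiom. -/
def Interp.satA [CommSemiring K] (I : Interp Δ K) : DLAxiom → K → Prop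
  | .cassert A a, κ => (I.indiv a, κ) ∈ I.conc A
  | .rassert R a b, κ => (I.indiv a, I.indiv b, κ) ∈ I.role R
  | .roleInc P Q, κ => ∀ d e κ', (d, e, κ') ∈ P.interp I → (d, e, κ * κ') ∈ Q.interp I
  | .roleDisj P Q, _ => ∀ d e κ₁ κ₂, (d, e, κ₁) ∈ P.interp I → (d, e, κ₂) ∈ Q.interp I → False
  | .gci C .bot, _ => C.interp I = ∅
  | .gci C D, κ => ∀ d κ', (d, κ') ∈ C.interp I → (d, κ * κ') ∈ D.interp I

/-! ### Conjunctive queries -/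

inductive DLTerm : Type
  | var : ℕ → DLTerm
  | ind : ℕ → DLTerm
deriving DecidableEq

/-- Query atoms: A(t) with A ∈ N_C ∪ {⊤}, or R(t,t') with R ∈ N_R. -/
inductive QAtom : Type
  | top : DLTerm → QAtom
  | conc : ℕ → DLTerm → QAtom
  | role : ℕ → DLTerm → DLTerm → QAtom
deriving DecidableEq

/-- A (Boolean) conjunctive query: a conjunction of atoms, all variables
existentially quantified. -/
abbrev BCQ := List QAtom

def Interp.tval (I : Interp Δ K) (π : ℕ → Δ) : DLTerm → Δ
  | .var v => π v
  | .ind a => I.indiv a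

/-- A match of the extended version of an atom, assigning value `κ` to its
annotation variable. -/
def QAtom.holds [CommSemiring K] (I : Interp Δ K) (π : ℕ → Δ) : QAtom → K → Prop
  | .top t, κ => I.tval π t ∈ I.dom ∧ κ = 1
  | .conc A t, κ => (I.tval π t, κ) ∈ I.conc A
  | .role R t t', κ => (I.tval π t, I.tval π t', κ) ∈ I.role R

/-- `I` satisfies the annotated BCQ (q, κ): some match of the extended version of `q`
gives κ as the product of the values of the annotation variables. -/
def Interp.satQ [CommSemiring K] (I : Interp Δ K) (q : BCQ) (κ : K) : Prop :=
  ∃ π : ℕ → Δ, (∀ v, π v ∈ I.dom) ∧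
    ∃ κs : List K, List.Forall₂ (fun a k => QAtom.holds I π a k) q κs ∧ κs.prod = κ

/-- A statement: an axiom or a BCQ. -/
inductive DLStmt : Type
  | ax : DLAxiom → DLStmt
  | query : BCQ → DLStmt

def Interp.satS [CommSemiring K] (I : Interp Δ K) : DLStmt → K → Prop
  | .ax α, κ => I.satA α κ
  | .query q, κ => I.satQ q κ

/-! ### Annotated ontologies, models and entailment -/

/-- The set of annotated axioms of the annotated ontology ⟨O, λ⟩. -/
def toAnn (O : Finset DLAxiom) (lam : DLAxiom → K) : Set (DLAxiom × K) :=
  {p | p.1 ∈ O ∧ p.2 = lam p.1}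

def isModel [CommSemiring K] (I : Interp Δ K) (Ω : Set (DLAxiom × K)) : Prop :=
  ∀ p ∈ Ω, I.satA p.1 p.2

/-- Satisfiability of a set of annotated axioms. -/
def AnnSat [CommSemiring K] (Ω : Set (DLAxiom × K)) : Prop :=
  ∃ (Δ : Type) (I : Interp Δ K), isModel I Ω

/-- Entailment of an annotated statement from a set of annotated axioms. -/
def Entails [CommSemiring K] (Ω : Set (DLAxiom × K)) (s : DLStmt) (κ : K) : Prop :=
  ∀ (Δ : Type) (I : Interp Δ K), isModel I Ω → I.satS s κ

/-! ### Non-annotated (plain) semantics -/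

structure PInterp (Δ : Type) where
  dom : Set Δ
  dom_nonempty : dom.Nonempty
  indiv : ℕ → Δ
  indiv_mem : ∀ a, indiv a ∈ dom
  conc : ℕ → Set Δ
  conc_mem : ∀ A d, d ∈ conc A → d ∈ dom
  role : ℕ → Set (Δ × Δ)
  role_mem : ∀ R p, p ∈ role R → p.1 ∈ dom ∧ p.2 ∈ dom

def DLRole.pinterp (I : PInterp Δ) : DLRole → Set (Δ × Δ)
  | .name R => I.role R
  | .inv R => {p | (p.2, p.1) ∈ I.role R}

def DLConcept.pinterp (I : PInterp Δ) : DLConcept → Set Δ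
  | .top => I.dom
  | .bot => ∅
  | .atom A => I.conc A
  | .inter C D => DLConcept.pinterp I C ∩ DLConcept.pinterp I D
  | .exis P C => {d | ∃ e, (d, e) ∈ DLRole.pinterp I P ∧ e ∈ DLConcept.pinterp I C}

def PInterp.satA (I : PInterp Δ) : DLAxiom → Prop
  | .cassert A a => I.indiv a ∈ I.conc A
  | .rassert R a b => (I.indiv a, I.indiv b) ∈ I.role R
  | .roleInc P Q => ∀ p ∈ P.pinterp I, p ∈ Q.pinterp I
  | .roleDisj P Q => ∀ p, p ∈ P.pinterp I → p ∈ Q.pinterp I → False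
  | .gci C D => C.pinterp I ⊆ D.pinterp I

def PInterp.tval (I : PInterp Δ) (π : ℕ → Δ) : DLTerm → Δ
  | .var v => π v
  | .ind a => I.indiv a

def QAtom.pholds (I : PInterp Δ) (π : ℕ → Δ) : QAtom → Prop
  | .top t => I.tval π t ∈ I.dom
  | .conc A t => I.tval π t ∈ I.conc A
  | .role R t t' => (I.tval π t, I.tval π t') ∈ I.role R

def PInterp.satQ (I : PInterp Δ) (q : BCQ) : Prop :=
  ∃ π : ℕ → Δ, (∀ v, π v ∈ I.dom) ∧ ∀ a ∈ q, QAtom.pholds I π a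

def PInterp.satS (I : PInterp Δ) : DLStmt → Prop
  | .ax α => I.satA α
  | .query q => I.satQ q

def isPModel (I : PInterp Δ) (O : Finset DLAxiom) : Prop := ∀ α ∈ O, I.satA α

def PSat (O : Finset DLAxiom) : Prop := ∃ (Δ : Type) (I : PInterp Δ), isPModel I O

def PEntails (O : Finset DLAxiom) (s : DLStmt) : Prop :=
  ∀ (Δ : Type) (I : PInterp Δ), isPModel I O → I.satS s

/-- A concept is satisfiable w.r.t. O if it has a nonempty extension in some model of O. -/
def CSat (O : Finset DLAxiom) (C : DLConcept) : Prop :=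
  ∃ (Δ : Type) (I : PInterp Δ), isPModel I O ∧ (C.pinterp I).Nonempty

/-- A role is satisfiable w.r.t. O if it has a nonempty extension in some model of O. -/
def RSat (O : Finset DLAxiom) (P : DLRole) : Prop :=
  ∃ (Δ : Type) (I : PInterp Δ), isPModel I O ∧ (P.pinterp I).Nonempty

/-- The plain interpretation obtained from an annotated one by dropping annotations. -/
def Interp.forget (I : Interp Δ K) : PInterp Δ where
  dom := I.dom
  dom_nonempty := I.dom_nonempty
  indiv := I.indiv
  indiv_mem := I.indiv_mem
  conc A := {d | ∃ κ, (d, κ) ∈ I.conc A}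
  conc_mem := fun A d hd => by obtain ⟨κ, hκ⟩ := hd; exact I.conc_mem A _ hκ
  role R := {p | ∃ κ, (p.1, p.2, κ) ∈ I.role R}
  role_mem := fun R p hp => by obtain ⟨κ, hκ⟩ := hp; exact I.role_mem R _ hκ

/-! ### ω-continuous commutative semirings and provenance -/

/-- The canonical preorder of a semiring: a ≤ b iff a ⊕ c = b for some c. -/
def canLE [Add K] (a b : K) : Prop := ∃ c, a + c = b

/-- The set of all sums of finite subsets of `S`. -/
def finSubsums [AddCommMonoid K] (S : Set K) : Set K :=
  {x | ∃ F : Finset K, ↑F ⊆ S ∧ F.sum id = x}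

/-- `u` is a least upper bound of `S` w.r.t. the canonical preorder. -/
def IsSupOf [Add K] (S : Set K) (u : K) : Prop :=
  (∀ a ∈ S, canLE a u) ∧ ∀ v, (∀ a ∈ S, canLE a v) → canLE u v

/-- ω-continuous commutative semirings: the canonical preorder is a partial order,
ω-chains have least upper bounds preserved by ⊕ and ⊗, and possibly infinite sums
are defined as suprema of finite subsums. -/
class OmegaCS (K : Type) extends CommSemiring K where
  canLE_antisymm : ∀ a b : K, canLE a b → canLE b a → a = b
  csup : (ℕ → K) → K
  csup_isSup : ∀ f : ℕ → K, (∀ n, canLE (f n) (f (n + 1))) → IsSupOf (Set.range f) (csup f)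
  add_csup : ∀ f : ℕ → K, (∀ n, canLE (f n) (f (n + 1))) →
      ∀ a : K, a + csup f = csup fun n => a + f n
  mul_csup : ∀ f : ℕ → K, (∀ n, canLE (f n) (f (n + 1))) →
      ∀ a : K, a * csup f = csup fun n => a * f n
  setSum : Set K → K
  setSum_isSup : ∀ S : Set K, IsSupOf (finSubsums S) (setSum S)

/-- The provenance of a statement w.r.t. a set of annotated axioms: the (possibly
infinite) sum of all κ such that (s, κ) is entailed. -/
def prov [OmegaCS K] (Ω : Set (DLAxiom × K)) (s : DLStmt) : K :=
  OmegaCS.setSum {κ | Entails Ω s κ}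

/-! ### Instance queries -/

/-- `qCt C t n` is the (body of) the instance query for the concept `C` with head
term `t`, using fresh variables starting from `n`; returns the query together with
the next fresh variable index. -/
def qCt : DLConcept → DLTerm → ℕ → BCQ × ℕ
  | .top, t, n => ([QAtom.top t], n)
  | .bot, t, n => ([QAtom.top t], n)
  | .atom A, t, n => ([QAtom.conc A t], n)
  | .inter C D, t, n =>
      let r₁ := qCt C t n
      let r₂ := qCt D t r₁.2
      (r₁.1 ++ r₂.1, r₂.2)
  | .exis (.name R) C, t, n =>
      let r := qCt C (.var n) (n + 1)
      (QAtom.role R t (.var n) :: r.1, r.2)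
  | .exis (.inv R) C, t, n =>
      let r := qCt C (.var n) (n + 1)
      (QAtom.role R (.var n) t :: r.1, r.2)

/-- The instance query q_C(a) for an individual name a. -/
def qCa (C : DLConcept) (a : ℕ) : BCQ := (qCt C (DLTerm.ind a) 0).1

/-! ### Database matches -/

def tvalN (σ : ℕ → ℕ) : DLTerm → ℕ
  | .var v => σ v
  | .ind a => a

def QAtom.dbHolds (O : Finset DLAxiom) (σ : ℕ → ℕ) : QAtom → Prop
  | .top _ => True
  | .conc A t => DLAxiom.cassert A (tvalN σ t) ∈ O
  | .role R t t' => DLAxiom.rassert R (tvalN σ t) (tvalN σ t') ∈ O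

/-- A database match of a BCQ in a set of assertions. -/
def isDBMatch (O : Finset DLAxiom) (σ : ℕ → ℕ) (q : BCQ) : Prop :=
  ∀ a ∈ q, QAtom.dbHolds O σ a

def QAtom.dbVal [CommSemiring K] (lam : DLAxiom → K) (σ : ℕ → ℕ) : QAtom → K
  | .top _ => 1
  | .conc A t => lam (DLAxiom.cassert A (tvalN σ t))
  | .role R t t' => lam (DLAxiom.rassert R (tvalN σ t) (tvalN σ t'))

/-- The ⊗-product, over the atoms of `q`, of the annotations of the matched facts. -/
def matchVal [CommSemiring K] (lam : DLAxiom → K) (σ : ℕ → ℕ) (q : BCQ) : K :=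
  (q.map (QAtom.dbVal lam σ)).prod

/-! ### Homomorphisms and canonical models -/

/-- Homomorphism between 𝕂-annotated interpretations. -/
def IsHom [CommSemiring K] (Ic : Interp Δ K) (I : Interp Δ' K) (g : Δ → Δ') : Prop :=
  Set.MapsTo g Ic.dom I.dom ∧ (∀ a, g (Ic.indiv a) = I.indiv a) ∧
  (∀ A d κ, (d, κ) ∈ Ic.conc A → (g d, κ) ∈ I.conc A) ∧
  (∀ R d e κ, (d, e, κ) ∈ Ic.role R → (g d, g e, κ) ∈ I.role R)

/-- Domain of canonical models: individual names (inl) plus fresh elements (inr). -/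
abbrev CD : Type := ℕ ⊕ ℕ

def baseConc (Ω : Set (DLAxiom × K)) (A : ℕ) : Set (CD × K) :=
  {p | ∃ a κ, (DLAxiom.cassert A a, κ) ∈ Ω ∧ p = (Sum.inl a, κ)}

def baseRole (Ω : Set (DLAxiom × K)) (R : ℕ) : Set (CD × CD × K) :=
  {p | ∃ a b κ, (DLAxiom.rassert R a b, κ) ∈ Ω ∧ p = (Sum.inl a, Sum.inl b, κ)}

/-- The initial interpretation I₀ of the canonical model construction. -/
def InitCan (Ω : Set (DLAxiom × K)) (I : Interp CD K) : Prop :=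
  I.dom = Set.range (Sum.inl : ℕ → CD) ∧ I.indiv = Sum.inl ∧
  (∀ A, I.conc A = baseConc Ω A) ∧ (∀ R, I.role R = baseRole Ω R)

/-- Where and how a tuple is inserted for the role `P`: the underlying role name
and the (suitably oriented) tuple. -/
def insRole (P : DLRole) (d e : CD) (κ : K) : ℕ × (CD × CD × K) :=
  match P with
  | .name R => (R, (d, e, κ))
  | .inv R => (R, (e, d, κ))

/-- One application of a rule of the canonical model construction. -/
def StepCan [CommSemiring K] (Ω : Set (DLAxiom × K)) (I J : Interp CD K) : Prop :=
  (∃ P Q κ d e κ', (DLAxiom.roleInc P Q, κ) ∈ Ω ∧ (d, e, κ') ∈ DLRole.interp I P ∧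
     J.dom = I.dom ∧ J.indiv = I.indiv ∧ (∀ A, J.conc A = I.conc A) ∧
     (∀ S, S ≠ (insRole Q d e (κ * κ')).1 → J.role S = I.role S) ∧
     J.role (insRole Q d e (κ * κ')).1 =
       insert (insRole Q d e (κ * κ')).2 (I.role (insRole Q d e (κ * κ')).1)) ∨
  (∃ C A κ d κ', (DLAxiom.gci C (DLConcept.atom A), κ) ∈ Ω ∧ (d, κ') ∈ DLConcept.interp I C ∧
     J.dom = I.dom ∧ J.indiv = I.indiv ∧ (∀ R, J.role R = I.role R) ∧
     (∀ B, B ≠ A → J.conc B = I.conc B) ∧ J.conc A = insert (d, κ * κ') (I.conc A)) ∨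
  (∃ C P κ d κ' df, (DLAxiom.gci C (DLConcept.exis P DLConcept.top), κ) ∈ Ω ∧
     (d, κ') ∈ DLConcept.interp I C ∧ df ∉ I.dom ∧
     J.dom = insert df I.dom ∧ J.indiv = I.indiv ∧ (∀ A, J.conc A = I.conc A) ∧
     (∀ S, S ≠ (insRole P d df (κ * κ')).1 → J.role S = I.role S) ∧
     J.role (insRole P d df (κ * κ')).1 =
       insert (insRole P d df (κ * κ')).2 (I.role (insRole P d df (κ * κ')).1))

/-- Fairness: every applicable rule instance has eventually been applied,
i.e. the limit is closed under the rules. -/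
def ClosedCan [CommSemiring K] (Ω : Set (DLAxiom × K)) (I : Interp CD K) : Prop :=
  (∀ P Q κ, (DLAxiom.roleInc P Q, κ) ∈ Ω →
      ∀ d e κ', (d, e, κ') ∈ DLRole.interp I P → (d, e, κ * κ') ∈ DLRole.interp I Q) ∧
  (∀ C A κ, (DLAxiom.gci C (DLConcept.atom A), κ) ∈ Ω →
      ∀ d κ', (d, κ') ∈ DLConcept.interp I C → (d, κ * κ') ∈ I.conc A) ∧
  (∀ C P κ, (DLAxiom.gci C (DLConcept.exis P DLConcept.top), κ) ∈ Ω →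
      ∀ d κ', (d, κ') ∈ DLConcept.interp I C → ∃ e, (d, e, κ * κ') ∈ DLRole.interp I P)

/-- `I` is the union of the increasing sequence `Iseq`. -/
def IsLimitOf (Iseq : ℕ → Interp CD K) (I : Interp CD K) : Prop :=
  I.dom = (⋃ n, (Iseq n).dom) ∧ I.indiv = (Iseq 0).indiv ∧
  (∀ A, I.conc A = ⋃ n, (Iseq n).conc A) ∧ (∀ R, I.role R = ⋃ n, (Iseq n).role R)

/-- `I` is a canonical model of the annotated ontology `Ω`. -/
def IsCanMod [CommSemiring K] (Ω : Set (DLAxiom × K)) (I : Interp CD K) : Prop :=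
  ∃ Iseq : ℕ → Interp CD K, InitCan Ω (Iseq 0) ∧
    (∀ n, Iseq (n + 1) = Iseq n ∨ StepCan Ω (Iseq n) (Iseq (n + 1))) ∧
    IsLimitOf Iseq I ∧ ClosedCan Ω I

/-- The initial interpretation of the canonical model construction for a basic
concept `C` annotated with `κ`, with distinguished fresh element `dC`. -/
def InitCanC [CommSemiring K] (Ω : Set (DLAxiom × K)) (C : DLConcept) (κ : K)
    (dC : CD) (I : Interp CD K) : Prop :=
  I.indiv = Sum.inl ∧ dC ∉ Set.range (Sum.inl : ℕ → CD) ∧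
  match C with
  | .atom A =>
      I.dom = insert dC (Set.range (Sum.inl : ℕ → CD)) ∧
      (∀ B, B ≠ A → I.conc B = baseConc Ω B) ∧
      I.conc A = insert (dC, κ) (baseConc Ω A) ∧
      (∀ R, I.role R = baseRole Ω R)
  | .exis P .top =>
      ∃ df, df ∉ Set.range (Sum.inl : ℕ → CD) ∧ df ≠ dC ∧
        I.dom = insert dC (insert df (Set.range (Sum.inl : ℕ → CD))) ∧
        (∀ B, I.conc B = baseConc Ω B) ∧
        (∀ S, S ≠ (insRole P dC df κ).1 → I.role S = baseRole Ω S) ∧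
        I.role (insRole P dC df κ).1 =
          insert (insRole P dC df κ).2 (baseRole Ω (insRole P dC df κ).1)
  | _ => False

/-- `I` is a canonical model of the basic concept `C`, annotation `κ` and `Ω`. -/
def IsCanModC [CommSemiring K] (Ω : Set (DLAxiom × K)) (C : DLConcept) (κ : K)
    (dC : CD) (I : Interp CD K) : Prop :=
  ∃ Iseq : ℕ → Interp CD K, InitCanC Ω C κ dC (Iseq 0) ∧
    (∀ n, Iseq (n + 1) = Iseq n ∨ StepCan Ω (Iseq n) (Iseq (n + 1))) ∧
    IsLimitOf Iseq I ∧ ClosedCan Ω I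



/-! ### The Why[X] provenance semiring: sets of monomials (finite sets of variables) -/

section Why
variable {V : Type} [DecidableEq V]

/-- Multiplication of sets of monomials. -/
def wmul (S T : Set (Finset V)) : Set (Finset V) := {m | ∃ s ∈ S, ∃ t ∈ T, m = s ∪ t}

instance whyZero : Zero (Set (Finset V)) := ⟨∅⟩
instance whyOne : One (Set (Finset V)) := ⟨{∅}⟩
instance whyAdd : Add (Set (Finset V)) := ⟨fun S T => S ∪ T⟩
instance whyMul : Mul (Set (Finset V)) := ⟨wmul⟩

instance whyCS : CommSemiring (Set (Finset V)) where
  add S T := S ∪ T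
  add_assoc := Set.union_assoc
  zero := ∅
  zero_add := Set.empty_union
  add_zero := Set.union_empty
  add_comm := Set.union_comm
  mul := wmul
  nsmul := nsmulRec
  npow := npowRec
  mul_assoc a b c := by
    show wmul (wmul a b) c = wmul a (wmul b c)
    ext m
    constructor
    · rintro ⟨s, ⟨x, hx, y, hy, rfl⟩, t, ht, rfl⟩
      exact ⟨x, hx, y ∪ t, ⟨y, hy, t, ht, rfl⟩, (Finset.union_assoc x y t)⟩
    · rintro ⟨s, hs, t, ⟨x, hx, y, hy, rfl⟩, rfl⟩
      exact ⟨s ∪ x, ⟨s, hs, x, hx, rfl⟩, y, hy, (Finset.union_assoc s x y).symm⟩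
  one := {∅}
  one_mul a := by
    show wmul {∅} a = a
    ext m
    constructor
    · rintro ⟨s, hs, t, ht, rfl⟩
      rw [Set.mem_singleton_iff] at hs
      subst hs; simpa using ht
    · intro hm; exact ⟨∅, rfl, m, hm, by simp⟩
  mul_one a := by
    show wmul a {∅} = a
    ext m
    constructor
    · rintro ⟨s, hs, t, ht, rfl⟩
      rw [Set.mem_singleton_iff] at ht
      subst ht; simpa using hs
    · intro hm; exact ⟨m, hm, ∅, rfl, by simp⟩
  mul_comm a b := by
    show wmul a b = wmul b a
    ext m
    constructor
    · rintro ⟨s, hs, t, ht, rfl⟩; exact ⟨t, ht, s, hs, Finset.union_comm s t⟩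
    · rintro ⟨s, hs, t, ht, rfl⟩; exact ⟨t, ht, s, hs, Finset.union_comm s t⟩
  left_distrib a b c := by
    show wmul a (b ∪ c) = wmul a b ∪ wmul a c
    ext m
    constructor
    · rintro ⟨s, hs, t, ht | ht, rfl⟩
      · exact Or.inl ⟨s, hs, t, ht, rfl⟩
      · exact Or.inr ⟨s, hs, t, ht, rfl⟩
    · rintro (⟨s, hs, t, ht, rfl⟩ | ⟨s, hs, t, ht, rfl⟩)
      · exact ⟨s, hs, t, Or.inl ht, rfl⟩
      · exact ⟨s, hs, t, Or.inr ht, rfl⟩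
  right_distrib a b c := by
    show wmul (a ∪ b) c = wmul a c ∪ wmul b c
    ext m
    constructor
    · rintro ⟨s, hs | hs, t, ht, rfl⟩
      · exact Or.inl ⟨s, hs, t, ht, rfl⟩
      · exact Or.inr ⟨s, hs, t, ht, rfl⟩
    · rintro (⟨s, hs, t, ht, rfl⟩ | ⟨s, hs, t, ht, rfl⟩)
      · exact ⟨s, Or.inl hs, t, ht, rfl⟩
      · exact ⟨s, Or.inr hs, t, ht, rfl⟩
  zero_mul a := by
    show wmul ∅ a = ∅
    ext m; constructor
    · rintro ⟨s, hs, _⟩; exact hs.elim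
    · rintro ⟨⟩
  mul_zero a := by
    show wmul a ∅ = ∅
    ext m; constructor
    · rintro ⟨s, hs, t, ht, _⟩; exact ht.elim
    · rintro ⟨⟩

/-- A monomial over `V`, viewed as an element of the Why semiring. -/
def wmon (m : Finset V) : Set (Finset V) := {m}

/-- The annotation variable of an axiom, as an element of the Why semiring. -/
def wvar (v : V) : Set (Finset V) := {({v} : Finset V)}

lemma why_zero_def : (0 : Set (Finset V)) = ∅ := rfl
lemma why_one_def : (1 : Set (Finset V)) = {∅} := rfl
lemma why_add_def (a b : Set (Finset V)) : a + b = a ∪ b := rfl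
lemma why_mul_def (a b : Set (Finset V)) : a * b = wmul a b := rfl

lemma why_canLE_iff (a b : Set (Finset V)) : canLE a b ↔ a ⊆ b := by
  constructor
  · rintro ⟨c, rfl⟩; exact Set.subset_union_left
  · intro h; exact ⟨b, Set.union_eq_right.mpr h⟩

end Why

/-! ### Normalization of Why[X]-annotated ELHI⊥ ontologies -/

/-- An ELHI concept that is neither a concept name nor ⊤. -/
def notAtomicELHI (C : DLConcept) : Prop :=
  C.botFree ∧ (∀ A, C ≠ DLConcept.atom A) ∧ C ≠ DLConcept.top

/-- A is a fresh concept name w.r.t. the ontology O. -/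
def freshC (A : ℕ) (O : Finset DLAxiom) : Prop := ∀ α ∈ O, A ∉ α.concNames

/-- One application of a normalization rule NF₁, NF₂ or NF₃ to a Why[X]-annotated
ontology (O, λ). -/
def NormStep :
    Finset DLAxiom × (DLAxiom → Set (Finset ℕ)) →
    Finset DLAxiom × (DLAxiom → Set (Finset ℕ)) → Prop := fun P P' =>
  -- NF₁ : (C ⊓ D̂ ⊑ E, v) ⟶ (D̂ ⊑ A, 1), (C ⊓ A ⊑ E, v)
  (∃ C Dh E A, DLAxiom.gci (DLConcept.inter C Dh) E ∈ P.1 ∧ notAtomicELHI Dh ∧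
      freshC A P.1 ∧
      P'.1 = insert (DLAxiom.gci Dh (DLConcept.atom A))
        (insert (DLAxiom.gci (DLConcept.inter C (DLConcept.atom A)) E)
          (P.1.erase (DLAxiom.gci (DLConcept.inter C Dh) E))) ∧
      P'.2 = Function.update
        (Function.update P.2 (DLAxiom.gci Dh (DLConcept.atom A)) 1)
        (DLAxiom.gci (DLConcept.inter C (DLConcept.atom A)) E)
        (P.2 (DLAxiom.gci (DLConcept.inter C Dh) E))) ∨
  -- NF₂ : (∃P.Ĉ ⊑ D, v) ⟶ (Ĉ ⊑ A, 1), (∃P.A ⊑ D, v)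
  (∃ Ch D Pr A, DLAxiom.gci (DLConcept.exis Pr Ch) D ∈ P.1 ∧ notAtomicELHI Ch ∧
      freshC A P.1 ∧
      P'.1 = insert (DLAxiom.gci Ch (DLConcept.atom A))
        (insert (DLAxiom.gci (DLConcept.exis Pr (DLConcept.atom A)) D)
          (P.1.erase (DLAxiom.gci (DLConcept.exis Pr Ch) D))) ∧
      P'.2 = Function.update
        (Function.update P.2 (DLAxiom.gci Ch (DLConcept.atom A)) 1)
        (DLAxiom.gci (DLConcept.exis Pr (DLConcept.atom A)) D)
        (P.2 (DLAxiom.gci (DLConcept.exis Pr Ch) D))) ∨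
  -- NF₃ : (Ĉ ⊑ ∃P, v) ⟶ (Ĉ ⊑ A, 1), (A ⊑ ∃P, v)
  (∃ Ch Pr A, DLAxiom.gci Ch (DLConcept.exis Pr DLConcept.top) ∈ P.1 ∧
      notAtomicELHI Ch ∧ freshC A P.1 ∧
      P'.1 = insert (DLAxiom.gci Ch (DLConcept.atom A))
        (insert (DLAxiom.gci (DLConcept.atom A) (DLConcept.exis Pr DLConcept.top))
          (P.1.erase (DLAxiom.gci Ch (DLConcept.exis Pr DLConcept.top)))) ∧
      P'.2 = Function.update
        (Function.update P.2 (DLAxiom.gci Ch (DLConcept.atom A)) 1)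
        (DLAxiom.gci (DLConcept.atom A) (DLConcept.exis Pr DLConcept.top))
        (P.2 (DLAxiom.gci Ch (DLConcept.exis Pr DLConcept.top))))

/-! ### Semantics under a change of the interpretation of one concept name -/

lemma DLRole.mem_dom_of_mem_interp (I : Interp Δ K) (P : DLRole) {p : Δ × Δ × K}
    (h : p ∈ P.interp I) : p.1 ∈ I.dom := by
  cases P with
  | name R => exact (I.role_mem R p h).1
  | inv R => exact (I.role_mem R _ h).2

lemma DLConcept.mem_dom_of_mem_interp [CommSemiring K] (I : Interp Δ K) (C : DLConcept)
    {p : Δ × K} (h : p ∈ C.interp I) : p.1 ∈ I.dom := by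
  induction C generalizing p with
  | top => exact h.1
  | bot => exact h.elim
  | atom A => exact I.conc_mem A p h
  | inter C D ihC _ =>
    obtain ⟨d, κ₁, κ₂, h₁, _, rfl⟩ := h
    exact ihC (p := (d, κ₁)) h₁
  | exis P C _ =>
    obtain ⟨d, e, κ₁, κ₂, h₁, _, rfl⟩ := h
    exact P.mem_dom_of_mem_interp I h₁

/-- The interpretation that agrees with `I` except that `A` is interpreted as `S`. -/
def Interp.setConc (I : Interp Δ K) (A : ℕ) (S : Set (Δ × K)) (hS : ∀ p ∈ S, p.1 ∈ I.dom) :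
    Interp Δ K where
  dom := I.dom
  dom_nonempty := I.dom_nonempty
  indiv := I.indiv
  indiv_mem := I.indiv_mem
  conc := Function.update I.conc A S
  conc_mem B p hp := by
    by_cases h : B = A
    · subst h
      exact hS p (by simpa using hp)
    · exact I.conc_mem B p (by simpa [h] using hp)
  role := I.role
  role_mem := I.role_mem

section setConc

variable (I : Interp Δ K) {A : ℕ} (S : Set (Δ × K)) (hS : ∀ p ∈ S, p.1 ∈ I.dom)

lemma Interp.setConc_conc_self : (I.setConc A S hS).conc A = S :=
  Function.update_self ..

lemma Interp.setConc_conc_of_ne {B : ℕ} (h : B ≠ A) :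
    (I.setConc A S hS).conc B = I.conc B :=
  Function.update_of_ne h ..

lemma DLRole.interp_setConc (P : DLRole) : P.interp (I.setConc A S hS) = P.interp I := by
  cases P <;> rfl

lemma DLConcept.interp_setConc [CommSemiring K] (C : DLConcept) (hC : A ∉ C.concNames) :
    C.interp (I.setConc A S hS) = C.interp I := by
  induction C with
  | top => rfl
  | bot => rfl
  | atom B =>
    exact I.setConc_conc_of_ne S hS (fun h => hC (by simp [DLConcept.concNames, h]))
  | inter C D ihC ihD =>
    simp only [DLConcept.concNames, Finset.mem_union, not_or] at hC
    simp only [DLConcept.interp, ihC hC.1, ihD hC.2]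
  | exis P C ih =>
    simp only [DLConcept.interp, ih hC, DLRole.interp_setConc]

lemma Interp.satA_setConc [CommSemiring K] (α : DLAxiom) (hα : A ∉ α.concNames) (κ : K) :
    (I.setConc A S hS).satA α κ ↔ I.satA α κ := by
  cases α with
  | cassert B a =>
    have hB : B ≠ A := fun h => hα (by simp [DLAxiom.concNames, h])
    simp only [Interp.satA, I.setConc_conc_of_ne S hS hB]
    rfl
  | rassert R a b => rfl
  | roleInc P Q => simp only [Interp.satA, DLRole.interp_setConc]
  | roleDisj P Q => simp only [Interp.satA, DLRole.interp_setConc]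
  | gci C D =>
    simp only [DLAxiom.concNames, Finset.mem_union, not_or] at hα
    cases D with
    | bot => simp only [Interp.satA, DLConcept.interp_setConc I S hS C hα.1]
    | _ =>
      simp only [Interp.satA, DLConcept.interp_setConc I S hS C hα.1,
        DLConcept.interp_setConc I S hS _ hα.2]

end setConc

lemma Interp.satA_gci_of_subset [CommSemiring K] (I : Interp Δ K) {B B' E : DLConcept} {κ : K}
    (hsub : B.interp I ⊆ B'.interp I) (h : I.satA (.gci B' E) κ) : I.satA (.gci B E) κ := by
  cases E with
  | bot =>
    have h' : B'.interp I = ∅ := h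
    exact Set.subset_eq_empty hsub h'
  | _ => exact fun d κ' hd => h d κ' (hsub hd)

lemma Interp.satA_gci_atom_one_iff [CommSemiring K] (I : Interp Δ K) (C : DLConcept) (A : ℕ) :
    I.satA (.gci C (.atom A)) 1 ↔ C.interp I ⊆ I.conc A := by
  simp only [Interp.satA, DLConcept.interp, one_mul]
  exact ⟨fun h p hp => h p.1 p.2 hp, fun h d κ hd => h hd⟩

lemma isModel_toAnn_iff [CommSemiring K] (I : Interp Δ K) (O : Finset DLAxiom)
    (lam : DLAxiom → K) : isModel I (toAnn O lam) ↔ ∀ α ∈ O, I.satA α (lam α) := by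
  constructor
  · exact fun h α hα => h (α, lam α) ⟨hα, rfl⟩
  · rintro h ⟨α, _⟩ ⟨hα, hκ⟩
    exact hκ ▸ h α hα

/-! ### Replacing a subconcept by a fresh name -/

/-- `B'` results from `B` by replacing a (positive) occurrence of `D` by the name `A`. -/
inductive Abbreviates (A : ℕ) (D : DLConcept) : DLConcept → DLConcept → Prop
  | self : Abbreviates A D D (.atom A)
  | inter (C : DLConcept) : Abbreviates A D (.inter C D) (.inter C (.atom A))
  | exis (P : DLRole) : Abbreviates A D (.exis P D) (.exis P (.atom A))

namespace Abbreviates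

variable {A : ℕ} {D B B' : DLConcept}

lemma mem_concNames (h : Abbreviates A D B B') : A ∈ B'.concNames := by
  cases h <;> simp [DLConcept.concNames]

lemma concNames_subset (h : Abbreviates A D B B') : D.concNames ⊆ B.concNames := by
  cases h <;> simp [DLConcept.concNames]

lemma concNames_subset_union (h : Abbreviates A D B B') :
    B.concNames ⊆ D.concNames ∪ B'.concNames := by
  cases h <;> intro x <;> simp [DLConcept.concNames] <;> tauto

lemma interp_subset [CommSemiring K] (h : Abbreviates A D B B') (I : Interp Δ K)
    (hA : D.interp I ⊆ I.conc A) : B.interp I ⊆ B'.interp I := by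
  cases h with
  | self => exact hA
  | inter C =>
    rintro _ ⟨d, κ₁, κ₂, h₁, h₂, rfl⟩
    exact ⟨d, κ₁, κ₂, h₁, hA h₂, rfl⟩
  | exis P =>
    rintro _ ⟨d, e, κ₁, κ₂, h₁, h₂, rfl⟩
    exact ⟨d, e, κ₁, κ₂, h₁, hA h₂, rfl⟩

lemma interp_superset [CommSemiring K] (h : Abbreviates A D B B') (I : Interp Δ K)
    (hA : I.conc A ⊆ D.interp I) : B'.interp I ⊆ B.interp I := by
  cases h with
  | self => exact hA
  | inter C =>
    rintro _ ⟨d, κ₁, κ₂, h₁, h₂, rfl⟩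
    exact ⟨d, κ₁, κ₂, h₁, hA h₂, rfl⟩
  | exis P =>
    rintro _ ⟨d, e, κ₁, κ₂, h₁, h₂, rfl⟩
    exact ⟨d, e, κ₁, κ₂, h₁, hA h₂, rfl⟩

end Abbreviates

lemma NormStep.exists_abbreviates {P P' : Finset DLAxiom × (DLAxiom → Set (Finset ℕ))}
    (h : NormStep P P') :
    ∃ A D B B' E, Abbreviates A D B B' ∧ DLAxiom.gci B E ∈ P.1 ∧ freshC A P.1 ∧
      P'.1 = insert (DLAxiom.gci D (.atom A))
        (insert (DLAxiom.gci B' E) (P.1.erase (DLAxiom.gci B E))) ∧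
      P'.2 = Function.update (Function.update P.2 (DLAxiom.gci D (.atom A)) 1)
        (DLAxiom.gci B' E) (P.2 (DLAxiom.gci B E)) := by
  rcases h with ⟨C, D, E, A, hmem, _, hA, h₁, h₂⟩ | ⟨D, E, Q, A, hmem, _, hA, h₁, h₂⟩ |
    ⟨D, Q, A, hmem, _, hA, h₁, h₂⟩
  · exact ⟨A, D, _, _, E, .inter C, hmem, hA, h₁, h₂⟩
  · exact ⟨A, D, _, _, E, .exis Q, hmem, hA, h₁, h₂⟩
  · exact ⟨A, D, _, _, _, .self, hmem, hA, h₁, h₂⟩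

section step

variable {P P' : Finset DLAxiom × (DLAxiom → Set (Finset ℕ))}

/-- Satisfaction of a normalized ontology, spelled out in terms of the original annotations. -/
lemma NormStep.exists_abbreviates_isModel_iff (h : NormStep P P') :
    ∃ A D B B' E, Abbreviates A D B B' ∧ DLAxiom.gci B E ∈ P.1 ∧ freshC A P.1 ∧
      ∀ (Δ : Type) (I : Interp Δ (Set (Finset ℕ))), isModel I (toAnn P'.1 P'.2) ↔
        D.interp I ⊆ I.conc A ∧ I.satA (.gci B' E) (P.2 (.gci B E)) ∧
          ∀ α ∈ P.1, α ≠ .gci B E → I.satA α (P.2 α) := by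
  obtain ⟨A, D, B, B', E, hab, hmem, hA, h₁, h₂⟩ := h.exists_abbreviates
  refine ⟨A, D, B, B', E, hab, hmem, hA, fun Δ I => ?_⟩
  have hne : DLAxiom.gci D (.atom A) ≠ .gci B' E := by
    intro h
    injection h with _ hE
    exact hA _ hmem (by simp [← hE, DLAxiom.concNames, DLConcept.concNames])
  have hl₁ : P'.2 (.gci D (.atom A)) = 1 := by
    rw [h₂, Function.update_of_ne hne, Function.update_self]
  have hl₂ : P'.2 (.gci B' E) = P.2 (.gci B E) := by
    rw [h₂, Function.update_self]
  have hl₃ : ∀ α ∈ P.1, P'.2 α = P.2 α := by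
    intro α hα
    have hα₁ : α ≠ .gci B' E := by
      rintro rfl
      exact hA _ hα (by simp [DLAxiom.concNames, hab.mem_concNames])
    have hα₂ : α ≠ .gci D (.atom A) := by
      rintro rfl
      exact hA _ hα (by simp [DLAxiom.concNames, DLConcept.concNames])
    rw [h₂, Function.update_of_ne hα₁, Function.update_of_ne hα₂]
  rw [isModel_toAnn_iff, h₁, Finset.forall_mem_insert, Finset.forall_mem_insert, hl₁, hl₂]
  refine and_congr (I.satA_gci_atom_one_iff D A) (and_congr Iff.rfl ?_)
  simp only [Finset.mem_erase]
  constructor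
  · intro h α hα hne
    exact hl₃ α hα ▸ h α ⟨hne, hα⟩
  · rintro h α ⟨hne, hα⟩
    exact (hl₃ α hα).symm ▸ h α hα hne

lemma NormStep.isModel_of_isModel (h : NormStep P P') (I : Interp Δ (Set (Finset ℕ)))
    (hI : isModel I (toAnn P'.1 P'.2)) : isModel I (toAnn P.1 P.2) := by
  obtain ⟨A, D, B, B', E, hab, -, -, hiff⟩ := h.exists_abbreviates_isModel_iff
  obtain ⟨hD, hB, hrest⟩ := (hiff Δ I).1 hI
  rw [isModel_toAnn_iff]
  intro α hα
  by_cases hαB : α = .gci B E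
  · subst hαB
    exact I.satA_gci_of_subset (hab.interp_subset I hD) hB
  · exact hrest α hα hαB

lemma NormStep.concNames_mem (h : NormStep P P') {A : ℕ} (hA : ∃ β ∈ P.1, A ∈ β.concNames) :
    ∃ β ∈ P'.1, A ∈ β.concNames := by
  obtain ⟨A', D, B, B', E, hab, -, -, h₁, -⟩ := h.exists_abbreviates
  obtain ⟨β, hβ, hAβ⟩ := hA
  rw [h₁]
  by_cases hβB : β = .gci B E
  · subst hβB
    simp only [DLAxiom.concNames, Finset.mem_union] at hAβ
    have hB : A ∈ B.concNames → A ∈ D.concNames ∨ A ∈ B'.concNames := fun h => by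
      simpa using hab.concNames_subset_union h
    by_cases hAD : A ∈ D.concNames
    · exact ⟨.gci D (.atom A'), by simp, by simp [DLAxiom.concNames, hAD]⟩
    · refine ⟨.gci B' E, by simp, ?_⟩
      simp only [DLAxiom.concNames, Finset.mem_union]
      tauto
  · exact ⟨β, by simp [hβ, hβB], hAβ⟩

lemma NormStep.entails_of_entails (h : NormStep P P') (α : DLAxiom)
    (hα : ∀ A ∈ α.concNames, ∃ β ∈ P.1, A ∈ β.concNames) {κ : Set (Finset ℕ)}
    (hent : Entails (toAnn P'.1 P'.2) (.ax α) κ) : Entails (toAnn P.1 P.2) (.ax α) κ := by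
  intro Δ I hI
  rw [isModel_toAnn_iff] at hI
  obtain ⟨A, D, B, B', E, hab, hmem, hA, hiff⟩ := h.exists_abbreviates_isModel_iff
  have hS : ∀ p ∈ D.interp I, p.1 ∈ I.dom := fun p hp => D.mem_dom_of_mem_interp I hp
  have hAα : A ∉ α.concNames := fun h => by
    obtain ⟨β, hβ, hAβ⟩ := hα A h
    exact hA β hβ hAβ
  have hAD : A ∉ D.concNames := fun h =>
    hA _ hmem (Finset.mem_union_left _ (hab.concNames_subset h))
  have hJ : ∀ β ∈ P.1, (I.setConc A (D.interp I) hS).satA β (P.2 β) := fun β hβ =>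
    (I.satA_setConc _ hS β (hA β hβ) _).2 (hI β hβ)
  have hconc : (I.setConc A (D.interp I) hS).conc A = D.interp (I.setConc A (D.interp I) hS) := by
    rw [DLConcept.interp_setConc I _ hS D hAD, I.setConc_conc_self]
  refine (I.satA_setConc _ hS α hAα κ).1 (hent Δ _ ((hiff Δ _).2 ⟨hconc.ge, ?_, ?_⟩))
  · exact Interp.satA_gci_of_subset _ (hab.interp_superset _ hconc.le) (hJ _ hmem)
  · exact fun β hβ _ => hJ β hβ

end step

lemma entails_of_normSteps {P P' : Finset DLAxiom × (DLAxiom → Set (Finset ℕ))}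
    (h : Relation.ReflTransGen NormStep P P') (α : DLAxiom)
    (hα : ∀ A ∈ α.concNames, ∃ β ∈ P.1, A ∈ β.concNames) {κ : Set (Finset ℕ)}
    (hent : Entails (toAnn P'.1 P'.2) (.ax α) κ) : Entails (toAnn P.1 P.2) (.ax α) κ := by
  induction h using Relation.ReflTransGen.head_induction_on with
  | refl => exact hent
  | head hstep _ ih =>
    exact hstep.entails_of_entails α hα (ih fun A hA => hstep.concNames_mem (hα A hA))

lemma isModel_of_normSteps {P P' : Finset DLAxiom × (DLAxiom → Set (Finset ℕ))}
    (h : Relation.ReflTransGen NormStep P P') (I : Interp Δ (Set (Finset ℕ)))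
    (hI : isModel I (toAnn P'.1 P'.2)) : isModel I (toAnn P.1 P.2) := by
  induction h using Relation.ReflTransGen.head_induction_on with
  | refl => exact hI
  | head hstep _ ih => exact hstep.isModel_of_isModel I ih

/-- If (O', λ') is obtained from a Why[X]-annotated ELHI⊥ ontology
(O, λ) by a finite sequence of applications of NF₁–NF₃, then (1) every model of
(O', λ') is a model of (O, λ); (2) for every axiom α whose concept names all occur in
O and every monomial m, if (O', λ') ⊨ (α, m) then (O, λ) ⊨ (α, m). -/
theorem statement15 (O O' : Finset DLAxiom) (lam lam' : DLAxiom → Set (Finset ℕ))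
    (hwf : ∀ α ∈ O, α.wf) (hnz : ∀ α ∈ O, lam α ≠ 0)
    (hsteps : Relation.ReflTransGen NormStep (O, lam) (O', lam')) :
    (∀ (Δ : Type) (I : Interp Δ (Set (Finset ℕ))),
        isModel I (toAnn O' lam') → isModel I (toAnn O lam)) ∧
    (∀ (α : DLAxiom) (m : Finset ℕ),
        (∀ A ∈ α.concNames, ∃ β ∈ O, A ∈ β.concNames) →
        Entails (toAnn O' lam') (DLStmt.ax α) {m} →
        Entails (toAnn O lam) (DLStmt.ax α) {m}) :=
  ⟨fun _ I hI => isModel_of_normSteps hsteps I hI,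
    fun α _ hα hent => entails_of_normSteps hsteps α hα hent⟩

end DLProv
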